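/- Let p ≥ 3 be an odd integer and n an integer divisible by 4 with 12 ≤ n ≤ 4p. Then the Graovac–Pisanski index of AT(n,p) satisfies Ŵ(AT(n,p)) = (p+1)·(n⁴/48 + (3n³p)/4 + (3n³)/4 + n²p² + 2n²p + (2n²)/3). -/

import Mathlib

open SimpleGraph

/-- Base relation for the armchair nanotube `AT(n,p)`: vertices are pairs `(i, j)` with
layer `i ∈ {0, …, p}` and position `j ∈ ℤ/2nℤ`.  `(i,j)` is related to `(i, j+1)`,
and to `(i+1, j-1)` when `j ≡ 2 (mod 4)`, and to `(i+1, j+1)` when `j ≡ 3 (mod 4)`. -/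
def ATRel (n p : ℕ) (u v : Fin (p + 1) × ZMod (2 * n)) : Prop :=
  (u.1 = v.1 ∧ v.2 = u.2 + 1) ∨
    ((u.1 : ℕ) + 1 = (v.1 : ℕ) ∧
      ((u.2.val % 4 = 2 ∧ v.2 = u.2 - 1) ∨ (u.2.val % 4 = 3 ∧ v.2 = u.2 + 1)))

/-- The armchair nanotube `AT(n,p)` as a simple graph. -/
def AT (n p : ℕ) : SimpleGraph (Fin (p + 1) × ZMod (2 * n)) :=
  SimpleGraph.fromRel (ATRel n p)

/-- `Vset n p k i` is the set `V^k_i` of vertices of type `k` in layer `i` of `AT(n,p)`: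
type `0` means `j mod 4 ∈ {0,1}`, type `1` means `j mod 4 ∈ {2,3}`. -/
def Vset (n p : ℕ) (k i : ℕ) : Set (Fin (p + 1) × ZMod (2 * n)) :=
  {v | (v.1 : ℕ) = i ∧ v.2.val % 4 / 2 = k}

/-- The set of vertices of `AT(n,p)` in layer `i` (the vertex set of the induced
cycle `C1` for `i = 0`, and of `C2` for `i = p`). -/
def layer (n p : ℕ) (i : ℕ) : Set (Fin (p + 1) × ZMod (2 * n)) :=
  {v | (v.1 : ℕ) = i}

/-- The Graovac–Pisanski index of a graph `G`:
`Ŵ(G) = (|V(G)| / (2 |Aut(G)|)) * Σ_u Σ_α d(u, α(u))`. -/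
noncomputable def GPindex {V : Type*} (G : SimpleGraph V) : ℚ :=
  ((Nat.card V : ℚ) / (2 * (Nat.card (G ≃g G) : ℚ))) *
    ∑ᶠ u : V, ∑ᶠ α : G ≃g G, (G.dist u (α u) : ℚ)

namespace ATProof

/-- adjacency written with natural number coordinates -/
def R (N a x b y : ℕ) : Prop :=
  (a = b ∧ (y = x + 1 ∨ (x + 1 = N ∧ y = 0))) ∨
  (a + 1 = b ∧ ((x % 4 = 2 ∧ y + 1 = x) ∨ (x % 4 = 3 ∧ (y = x + 1 ∨ (x + 1 = N ∧ y = 0)))))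

variable {n p : ℕ}

lemma val_succ (h : 2 ≤ n) (x : ZMod (2 * n)) :
    ((x + 1).val = x.val + 1) ∨ (x.val + 1 = 2 * n ∧ (x + 1).val = 0) := by
  have : NeZero (2 * n) := ⟨by omega⟩
  have : Fact (1 < 2 * n) := ⟨by omega⟩
  have hx := ZMod.val_lt x
  have h1 : (x + 1).val = (x.val + 1) % (2 * n) := by
    rw [ZMod.val_add, ZMod.val_one]
  rcases Nat.lt_or_ge (x.val + 1) (2 * n) with h2 | h2
  · left; rw [h1, Nat.mod_eq_of_lt h2]
  · right
    have h3 : x.val + 1 = 2 * n := by omega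
    refine ⟨h3, ?_⟩
    rw [h1, h3, Nat.mod_self]

lemma rel_R (h : 2 ≤ n) {v w : Fin (p + 1) × ZMod (2 * n)} (hr : ATRel n p v w) :
    R (2 * n) v.1 v.2.val w.1 w.2.val := by
  have : NeZero (2 * n) := ⟨by omega⟩
  rcases hr with ⟨h1, h2⟩ | ⟨h1, ⟨h2, h3⟩ | ⟨h2, h3⟩⟩
  · left
    refine ⟨by rw [h1], ?_⟩
    have := val_succ h v.2
    rw [← h2] at this
    tauto
  · right
    refine ⟨h1, Or.inl ⟨h2, ?_⟩⟩
    have h4 : v.2 = w.2 + 1 := by rw [h3]; ring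
    have := val_succ h w.2
    rw [← h4] at this
    omega
  · right
    refine ⟨h1, Or.inr ⟨h2, ?_⟩⟩
    have := val_succ h v.2
    rw [← h3] at this
    tauto

lemma adj_R (h : 2 ≤ n) {v w : Fin (p + 1) × ZMod (2 * n)} (hr : (AT n p).Adj v w) :
    R (2 * n) v.1 v.2.val w.1 w.2.val ∨ R (2 * n) w.1 w.2.val v.1 v.2.val := by
  rw [AT, SimpleGraph.fromRel_adj] at hr
  exact hr.2.imp (rel_R h) (rel_R h)

lemma adj_of_rel (h : 2 ≤ n) {v w : Fin (p + 1) × ZMod (2 * n)} (hr : ATRel n p v w) :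
    (AT n p).Adj v w := by
  rw [AT, SimpleGraph.fromRel_adj]
  refine ⟨?_, Or.inl hr⟩
  rintro rfl
  have := rel_R h hr
  unfold R at this
  omega

lemma val_mod4 (h : 2 ≤ n) (h2 : 2 ∣ n) (z : ℤ) :
    (((z : ZMod (2 * n)).val : ℤ)) % 4 = z % 4 := by
  have : NeZero (2 * n) := ⟨by omega⟩
  rw [ZMod.val_intCast]
  apply Int.emod_emod_of_dvd
  obtain ⟨k, rfl⟩ := h2
  exact ⟨k, by push_cast; ring⟩

/-- vertex with integer coordinate -/
def P (n p : ℕ) (i : ℕ) (z : ℤ) : Fin (p + 1) × ZMod (2 * n) := (Fin.ofNat (p + 1) i, (z : ZMod (2 * n)))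

lemma P_val {i : ℕ} (hi : i ≤ p) (z : ℤ) : ((P n p i z).1 : ℕ) = i := by
  simp [P, Fin.ofNat]; omega

lemma P_eq (h : 2 ≤ n) (v : Fin (p + 1) × ZMod (2 * n)) : v = P n p v.1 v.2.val := by
  have : NeZero (2 * n) := ⟨by omega⟩
  ext1
  · apply Fin.ext
    rw [P_val]
    omega
  · simp [P]

lemma P_adj0 (h : 2 ≤ n) (i : ℕ) (z : ℤ) : (AT n p).Adj (P n p i z) (P n p i (z + 1)) := by
  apply adj_of_rel h
  left
  simp [P]

lemma P_adj3 (h : 2 ≤ n) (h2 : 2 ∣ n) {i : ℕ} (hi : i + 1 ≤ p) {z : ℤ} (hz : z % 4 = 3) :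
    (AT n p).Adj (P n p i z) (P n p (i + 1) (z + 1)) := by
  apply adj_of_rel h
  right
  rw [P_val (by omega), P_val hi]
  refine ⟨rfl, Or.inr ⟨?_, by simp [P]⟩⟩
  have := val_mod4 h h2 z
  simp only [P]
  omega

lemma P_adj2 (h : 2 ≤ n) (h2 : 2 ∣ n) {i : ℕ} (hi : i + 1 ≤ p) {z : ℤ} (hz : z % 4 = 2) :
    (AT n p).Adj (P n p i z) (P n p (i + 1) (z - 1)) := by
  apply adj_of_rel h
  right
  rw [P_val (by omega), P_val hi]
  refine ⟨rfl, Or.inl ⟨?_, by simp [P]⟩⟩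
  have := val_mod4 h h2 z
  simp only [P]
  omega

/-! ### walks -/

/-- there is a walk of length at most `k` (with integers) -/
def Reach {α : Type*} (G : SimpleGraph α) (u v : α) (k : ℤ) : Prop := ∃ w : G.Walk u v, (w.length : ℤ) = k

lemma Reach.trans {α : Type*} {G : SimpleGraph α} {u v w : α} {k l : ℤ}
    (h1 : Reach G u v k) (h2 : Reach G v w l) : Reach G u w (k + l) := by
  obtain ⟨a, ha⟩ := h1
  obtain ⟨b, hb⟩ := h2
  exact ⟨a.append b, by simp [ha, hb]⟩

lemma Reach.symm {α : Type*} {G : SimpleGraph α} {u v : α} {k : ℤ}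
    (h1 : Reach G u v k) : Reach G v u k := by
  obtain ⟨a, ha⟩ := h1
  exact ⟨a.reverse, by simp [ha]⟩

lemma Reach.refl {α : Type*} {G : SimpleGraph α} (u : α) : Reach G u u 0 := ⟨.nil, by simp⟩

lemma Reach.of_adj {α : Type*} {G : SimpleGraph α} {u v : α} (h : G.Adj u v) : Reach G u v 1 :=
  ⟨.cons h .nil, by simp⟩

lemma Reach.dist_le {α : Type*} {G : SimpleGraph α} {u v : α} {k : ℤ}
    (h1 : Reach G u v k) : (G.dist u v : ℤ) ≤ k := by
  obtain ⟨a, ha⟩ := h1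
  have := SimpleGraph.dist_le a
  omega

lemma Reach.reachable {α : Type*} {G : SimpleGraph α} {u v : α} {k : ℤ}
    (h1 : Reach G u v k) : G.Reachable u v := by
  obtain ⟨a, ha⟩ := h1
  exact ⟨a⟩

lemma Reach.cast {α : Type*} {G : SimpleGraph α} {u v v' : α} {k k' : ℤ}
    (h1 : Reach G u v k) (hv : v = v') (hk : k = k') : Reach G u v' k' := by
  subst hv hk; exact h1

lemma reach_right (h : 2 ≤ n) (i : ℕ) (z : ℤ) (m : ℕ) :
    Reach (AT n p) (P n p i z) (P n p i (z + m)) m := by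
  induction m with
  | zero => simpa using Reach.refl _
  | succ m ih =>
    refine (ih.trans (Reach.of_adj (P_adj0 h i _))).cast ?_ ?_
    · push_cast; congr 1; ring
    · push_cast; ring

lemma reach_le (h : 2 ≤ n) (i : ℕ) {z z' : ℤ} (hz : z ≤ z') :
    Reach (AT n p) (P n p i z) (P n p i z') (z' - z) := by
  obtain ⟨m, rfl⟩ := Int.le.dest hz
  exact (reach_right h i z m).cast rfl (by ring)

lemma reach_ge (h : 2 ≤ n) (i : ℕ) {z z' : ℤ} (hz : z' ≤ z) :
    Reach (AT n p) (P n p i z) (P n p i z') (z - z') := (reach_le h i hz).symm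

/-- diagonal, up, right -/
lemma reach_ur (h : 2 ≤ n) (h2 : 2 ∣ n) (i m : ℕ) (hm : i + m ≤ p) :
    Reach (AT n p) (P n p i 0) (P n p (i + m) (4 * m)) (4 * m) := by
  induction m with
  | zero => simpa using Reach.refl _
  | succ m ih =>
    refine (((ih (by omega)).trans
      (reach_le h (i + m) (z' := 4 * m + 3) (by omega))).trans
      (Reach.of_adj (P_adj3 h h2 (by omega) (by omega)))).cast ?_ ?_
    · push_cast; congr 1
    · push_cast; ring

lemma reach_ul (h : 2 ≤ n) (h2 : 2 ∣ n) (i m : ℕ) (hm : i + m ≤ p) :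
    Reach (AT n p) (P n p i 0) (P n p (i + m) (-(4 * m))) (4 * m) := by
  induction m with
  | zero => simpa using Reach.refl _
  | succ m ih =>
    refine ((((ih (by omega)).trans
      (reach_ge h (i + m) (z' := -(4 * m) - 2) (by omega))).trans
      (Reach.of_adj (P_adj2 h h2 (by omega) (by omega)))).trans 
      (reach_ge h (i + m + 1) (z' := -(4 * m) - 4) (by omega))).cast ?_ ?_
    · push_cast; congr 1; ring
    · push_cast; ring

lemma step_dr (h : 2 ≤ n) (h2 : 2 ∣ n) {i : ℕ} (hi : i + 1 ≤ p) {z : ℤ} (hz : z % 4 = 0) :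
    Reach (AT n p) (P n p (i + 1) z) (P n p i (z + 2)) 2 := by
  refine ((reach_le h (i + 1) (z' := z + 1) (by omega)).trans
    (Reach.of_adj (P_adj2 h h2 hi (z := z + 2) (by omega)).symm |>.cast rfl rfl |> fun x => ?_)).cast rfl
    (show (z + 1 - z) + 1 = 2 by ring)
  have e : z + 2 - 1 = z + 1 := by ring
  rw [e] at x
  exact x

lemma step_dl (h : 2 ≤ n) (h2 : 2 ∣ n) {i : ℕ} (hi : i + 1 ≤ p) {z : ℤ} (hz : z % 4 = 0) :
    Reach (AT n p) (P n p (i + 1) z) (P n p i (z - 1)) 1 := by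
  have := (P_adj3 h h2 hi (z := z - 1) (by omega)).symm
  rw [sub_add_cancel] at this
  exact Reach.of_adj this

lemma reach_dr (h : 2 ≤ n) (h2 : 2 ∣ n) (i m : ℕ) (hm : i + m ≤ p) :
    Reach (AT n p) (P n p (i + m) 0) (P n p i (4 * m)) (4 * m) := by
  induction m generalizing i with
  | zero => simpa using Reach.refl _
  | succ m ih =>
    have := ih (i + 1) (by omega)
    rw [show i + 1 + m = i + (m + 1) by ring] at this
    refine ((this.trans (step_dr h h2 (by omega) (by omega))).trans
      (reach_le h i (z' := 4 * m + 4) (by omega))).cast ?_ ?_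
    · push_cast; congr 1
    · push_cast; ring

lemma reach_dl (h : 2 ≤ n) (h2 : 2 ∣ n) (i m : ℕ) (hm : i + m ≤ p) :
    Reach (AT n p) (P n p (i + m) 0) (P n p i (-(4 * m))) (4 * m) := by
  induction m generalizing i with
  | zero => simpa using Reach.refl _
  | succ m ih =>
    have := ih (i + 1) (by omega)
    rw [show i + 1 + m = i + (m + 1) by ring] at this
    refine ((this.trans (step_dl h h2 (by omega) (by omega))).trans
      (reach_ge h i (z' := -(4 * m) - 4) (by omega))).cast ?_ ?_
    · push_cast; congr 1; ring
    · push_cast; ring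

lemma reach_vert (h : 2 ≤ n) (h2 : 2 ∣ n) (i m : ℕ) (hm : i + m ≤ p) (z : ℤ)
    (hz : z % 4 = 2 ∨ z % 4 = 3) :
    Reach (AT n p) (P n p i z) (P n p (i + m) z) (2 * m) := by
  induction m with
  | zero => simpa using Reach.refl _
  | succ m ih =>
    rcases hz with hz | hz
    · refine (((ih (by omega)).trans (Reach.of_adj (P_adj2 h h2 (by omega) hz))).trans
        (reach_le h _ (z' := z) (by omega))).cast ?_ ?_
      · push_cast; congr 1
      · push_cast; ring
    · refine (((ih (by omega)).trans (Reach.of_adj (P_adj3 h h2 (by omega) hz))).trans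
        (reach_ge h _ (z' := z) (by omega))).cast ?_ ?_
      · push_cast; congr 1
      · push_cast; ring

/-- upper bounds to type 1 targets -/
lemma up_right (h : 2 ≤ n) (h2 : 2 ∣ n) (i k m : ℕ) (hk : i + k ≤ p) (hm : m ≤ k) (z : ℤ)
    (hz : z % 4 = 2 ∨ z % 4 = 3) (hmz : 4 * m ≤ z) :
    Reach (AT n p) (P n p i 0) (P n p (i + k) z) (z + 2 * (k - m)) := by
  have := reach_vert (p := p) h h2 (i + m) (k - m) (by omega) z hz
  rw [show i + m + (k - m) = i + k by omega] at this
  refine (((reach_ur h h2 i m (by omega)).trans (reach_le h _ hmz)).trans this).cast rfl ?_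
  push_cast [hm]; ring

lemma up_left (h : 2 ≤ n) (h2 : 2 ∣ n) (i k m : ℕ) (hk : i + k ≤ p) (hm : m ≤ k) (z : ℤ)
    (hz : z % 4 = 2 ∨ z % 4 = 3) (hmz : 4 * m ≤ -z) :
    Reach (AT n p) (P n p i 0) (P n p (i + k) z) (-z + 2 * (k - m)) := by
  have := reach_vert (p := p) h h2 (i + m) (k - m) (by omega) z hz
  rw [show i + m + (k - m) = i + k by omega] at this
  refine (((reach_ul h h2 i m (by omega)).trans (reach_ge h _ (by omega))).trans this).cast rfl ?_
  push_cast [hm]; ring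

lemma down_right (h : 2 ≤ n) (h2 : 2 ∣ n) (i k m : ℕ) (hk : i + k + 1 ≤ p) (hm : m ≤ k) (z : ℤ)
    (hz : z % 4 = 2 ∨ z % 4 = 3) (hmz : 4 * m + 2 ≤ z) :
    Reach (AT n p) (P n p (i + k + 1) 0) (P n p i z) (z + 2 * (k - m)) := by
  have h3 := (reach_vert (p := p) h h2 i (k - m) (by omega) z hz).symm
  have h4 := reach_dr (p := p) h h2 (i + (k - m) + 1) m (by omega)
  rw [show i + (k - m) + 1 + m = i + k + 1 by omega] at h4
  refine (((h4.trans (step_dr h h2 (by omega) (by omega))).trans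
    (reach_le h _ hmz)).trans h3).cast rfl ?_
  push_cast [hm]; ring

lemma down_left (h : 2 ≤ n) (h2 : 2 ∣ n) (i k m : ℕ) (hk : i + k + 1 ≤ p) (hm : m ≤ k) (z : ℤ)
    (hz : z % 4 = 2 ∨ z % 4 = 3) (hmz : 4 * m + 1 ≤ -z) :
    Reach (AT n p) (P n p (i + k + 1) 0) (P n p i z) (-z + 2 * (k - m)) := by
  have h3 := (reach_vert (p := p) h h2 i (k - m) (by omega) z hz).symm
  have h4 := reach_dl (p := p) h h2 (i + (k - m) + 1) m (by omega)
  rw [show i + (k - m) + 1 + m = i + k + 1 by omega] at h4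
  refine (((h4.trans (step_dl h h2 (by omega) (by omega))).trans
    (reach_ge h _ (by omega))).trans h3).cast rfl ?_
  push_cast [hm]; ring

lemma P_per (i : ℕ) (z : ℤ) : P n p i (z - 2 * n) = P n p i z := by
  have : ((2 * n : ℕ) : ZMod (2 * n)) = 0 := ZMod.natCast_self _
  push_cast at this
  simp [P, this]

/-! ### lower bounds -/

lemma lip {α : Type*} {G : SimpleGraph α} (f : α → ℤ) (hf : ∀ u v, G.Adj u v → f v ≤ f u + 1)
    {u v : α} (hr : G.Reachable u v) : f v ≤ f u + G.dist u v := by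
  obtain ⟨w, hw⟩ := hr.exists_walk_length_eq_dist
  rw [← hw]
  clear hw
  induction w with
  | nil => simp
  | cons hadj w ih =>
    have := hf _ _ hadj
    have := ih w.reachable
    simp only [SimpleGraph.Walk.length_cons]; push_cast
    omega

lemma lip_j (h : 2 ≤ n) (h2 : 4 ∣ n) (u v : Fin (p + 1) × ZMod (2 * n)) (hr : (AT n p).Adj u v) :
    ((min v.2.val (2 * n - v.2.val) : ℕ) : ℤ) ≤ ((min u.2.val (2 * n - u.2.val) : ℕ) : ℤ) + 1 := by
  have : NeZero (2 * n) := ⟨by omega⟩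
  have := adj_R h hr
  have := ZMod.val_lt u.2
  have := ZMod.val_lt v.2
  unfold R at *
  omega

/-- level -/
def lev (v : Fin (p + 1) × ZMod (2 * n)) : ℤ := 2 * (v.1 : ℕ) + (v.2.val % 4 / 2 : ℕ)

/-- column distance to column zero -/
def col (v : Fin (p + 1) × ZMod (2 * n)) : ℕ := min ((v.2.val + 1) / 2) (n - (v.2.val + 1) / 2)

lemma lip_c (h : 2 ≤ n) (h2 : 4 ∣ n) (l : ℤ) (u v : Fin (p + 1) × ZMod (2 * n))
    (hr : (AT n p).Adj u v) :
    (col v : ℤ) + (lev v - l).natAbs ≤ ((col u : ℤ) + (lev u - l).natAbs) + 1 := by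
  have : NeZero (2 * n) := ⟨by omega⟩
  have := adj_R h hr
  have := ZMod.val_lt u.2
  have := ZMod.val_lt v.2
  unfold R col lev at *
  obtain ⟨k, rfl⟩ := h2
  omega

/-- the distance formula -/
def E (n p i x : ℕ) : ℕ :=
  if x % 4 < 2 then min x (2 * n - x)
  else max (min x (2 * n - x)) (min ((x + 1) / 2) (n - (x + 1) / 2) + (2 * ((p : ℤ) - 2 * i) + 1).natAbs)

/-- the orbit map on layers -/
def sg (p x i : ℕ) : ℕ := if x % 4 < 2 then i else p - i

lemma dist_upper (h : 2 ≤ n) (h2 : 4 ∣ n) (i x : ℕ) (hi : i ≤ p) (hx : x < 2 * n) :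
    ∃ k : ℤ, k ≤ E n p i x ∧ Reach (AT n p) (P n p i 0) (P n p (sg p x i) x) k := by
  have h2' : 2 ∣ n := by omega
  unfold E sg
  split_ifs with ht
  · rcases Nat.le_total x n with hl | hl
    · exact ⟨_, by omega, reach_le h i (z := 0) (z' := x) (by omega)⟩
    · exact ⟨_, by omega, (reach_ge h i (z := 0) (z' := x - 2 * n) (by omega)).cast (P_per _ _) rfl⟩
  · rcases Nat.le_total (2 * i) p with hd | hd
    · -- up, k = p - 2 i
      rcases Nat.lt_or_ge x n with hl | hl
      · have := up_right h h2' (p := p) i (p - 2 * i) (min (p - 2 * i) (x / 4)) (by omega) (by omega)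
          x (by omega) (by omega)
        rw [show i + (p - 2 * i) = p - i by omega] at this
        exact ⟨_, by omega, this⟩
      · have := up_left h h2' (p := p) i (p - 2 * i) (min (p - 2 * i) ((2 * n - x) / 4)) (by omega) (by omega)
          (x - 2 * n) (by omega) (by omega)
        rw [show i + (p - 2 * i) = p - i by omega, P_per] at this
        exact ⟨_, by omega, this⟩
    · rcases Nat.eq_or_lt_of_le hd with he | hd
      · rcases Nat.lt_or_ge x n with hl | hl
        · have := up_right h h2' (p := p) i 0 0 (by omega) (by omega)
            x (by omega) (by omega)
          rw [show i + 0 = p - i by omega] at this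
          exact ⟨_, by omega, this⟩
        · have := up_left h h2' (p := p) i 0 0 (by omega) (by omega)
            (x - 2 * n) (by omega) (by omega)
          rw [show i + 0 = p - i by omega, P_per] at this
          exact ⟨_, by omega, this⟩
      · rcases Nat.lt_or_ge x n with hl | hl
        · have := down_right h h2' (p := p) (p - i) (2 * i - p - 1) (min (2 * i - p - 1) (x / 4))
            (by omega) (by omega) x (by omega) (by omega)
          rw [show p - i + (2 * i - p - 1) + 1 = i by omega] at this
          exact ⟨_, by omega, this⟩
        · have := down_left h h2' (p := p) (p - i) (2 * i - p - 1) (min (2 * i - p - 1) ((2 * n - x) / 4))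
            (by omega) (by omega) (x - 2 * n) (by omega) (by omega)
          rw [show p - i + (2 * i - p - 1) + 1 = i by omega, P_per] at this
          exact ⟨_, by omega, this⟩

lemma dist_eq (h : 2 ≤ n) (h2 : 4 ∣ n) (i x : ℕ) (hi : i ≤ p) (hx : x < 2 * n) :
    (AT n p).dist (P n p i 0) (P n p (sg p x i) x) = E n p i x := by
  have : NeZero (2 * n) := ⟨by omega⟩
  obtain ⟨k, hk, hr⟩ := dist_upper h h2 i x hi hx
  have hs : sg p x i ≤ p := by unfold sg; split_ifs <;> omega
  apply le_antisymm
  · have := hr.dist_le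
    omega
  · have l1 := lip _ (lip_j h h2) hr.reachable
    have l2 := lip _ (lip_c h h2 (2 * i)) hr.reachable
    have v0 : (P n p i 0).2.val = 0 := by simp [P]
    have v1 : (P n p (sg p x i) x).2.val = x := by
      simp only [P, Int.cast_natCast]; exact ZMod.val_cast_of_lt hx
    simp only [lev, col, v0, v1, P_val hi, P_val hs] at l1 l2
    generalize (AT n p).dist (P n p i 0) (P n p (sg p x i) x) = d at *
    unfold E
    unfold sg at l2
    split_ifs at * <;> omega


/-! ### automorphisms -/

lemma adj_iff (v w : Fin (p + 1) × ZMod (2 * n)) (h : 2 ≤ n) :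
    (AT n p).Adj v w ↔ ATRel n p v w ∨ ATRel n p w v := by
  constructor
  · intro hr
    rw [AT, SimpleGraph.fromRel_adj] at hr
    exact hr.2
  · rintro (hr | hr)
    · exact adj_of_rel h hr
    · exact (adj_of_rel h hr).symm

/-- build an automorphism from a permutation that maps edges to edges both ways -/
def mkIso (h : 2 ≤ n) (e : (Fin (p + 1) × ZMod (2 * n)) ≃ (Fin (p + 1) × ZMod (2 * n)))
    (h1 : ∀ v w, ATRel n p v w → ATRel n p (e v) (e w) ∨ ATRel n p (e w) (e v))
    (h2 : ∀ v w, ATRel n p v w → ATRel n p (e.symm v) (e.symm w) ∨ ATRel n p (e.symm w) (e.symm v)) :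
    AT n p ≃g AT n p where
  toEquiv := e
  map_rel_iff' := by
    intro a b
    rw [adj_iff _ _ h, adj_iff _ _ h]
    constructor
    · rintro (hr | hr)
      · simpa using h2 _ _ hr
      · simpa using (h2 _ _ hr).symm
    · rintro (hr | hr)
      · exact h1 _ _ hr
      · exact (h1 _ _ hr).symm

lemma val_add_mod4 (h : 2 ≤ n) (h2 : 2 ∣ n) (x y : ZMod (2 * n)) :
    (x + y).val % 4 = (x.val + y.val) % 4 := by
  have : NeZero (2 * n) := ⟨by omega⟩
  rw [ZMod.val_add]
  apply Nat.mod_mod_of_dvd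
  obtain ⟨k, rfl⟩ := h2
  exact ⟨k, by ring⟩

lemma val_sub_mod4 (h : 2 ≤ n) (h2 : 2 ∣ n) (x y : ZMod (2 * n)) :
    ((x - y).val + y.val) % 4 = x.val % 4 := by
  rw [← val_add_mod4 h h2, sub_add_cancel]

lemma val_one (h : 2 ≤ n) : (1 : ZMod (2 * n)).val = 1 := by
  have : Fact (1 < 2 * n) := ⟨by omega⟩
  exact ZMod.val_one _

lemma val_two (h : 2 ≤ n) : (2 : ZMod (2 * n)).val = 2 := by
  exact ZMod.val_cast_of_lt (n := 2 * n) (a := 2) (by omega)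

/-- translation -/
lemma exT (h : 2 ≤ n) (h2 : 2 ∣ n) (t : ZMod (2 * n)) (ht : t.val % 4 = 0) :
    ∃ g : AT n p ≃g AT n p, ∀ i x, g (i, x) = (i, x + t) := by
  have key : ∀ t : ZMod (2 * n), t.val % 4 = 0 → ∀ v w, ATRel n p v w → 
      ATRel n p (v.1, v.2 + t) (w.1, w.2 + t) := by
    intro t ht v w hr
    have e := val_add_mod4 h h2 v.2 t
    rcases hr with ⟨a, b⟩ | ⟨a, ⟨b, c⟩ | ⟨b, c⟩⟩
    · left; exact ⟨a, by simp only [b]; ring⟩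
    · right; exact ⟨a, Or.inl ⟨by simp only []; omega, by simp only [c]; ring⟩⟩
    · right; exact ⟨a, Or.inr ⟨by simp only []; omega, by simp only [c]; ring⟩⟩
  have ht' : (-t).val % 4 = 0 := by
    have := val_sub_mod4 h h2 0 t
    simp at this
    omega
  refine ⟨mkIso h ⟨fun v => (v.1, v.2 + t), fun v => (v.1, v.2 + -t), fun v => by simp,
    fun v => by simp⟩ (fun v w hr => Or.inl (key t ht v w hr))
    (fun v w hr => Or.inl (key (-t) ht' v w hr)), fun i x => rfl⟩

/-- reflection -/
lemma exS (h : 2 ≤ n) (h2 : 2 ∣ n) :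
    ∃ g : AT n p ≃g AT n p, ∀ i x, g (i, x) = (i, 1 - x) := by
  have key : ∀ v w, ATRel n p v w → 
      ATRel n p (v.1, 1 - v.2) (w.1, 1 - w.2) ∨ ATRel n p (w.1, 1 - w.2) (v.1, 1 - v.2) := by
    intro v w hr
    have e := val_sub_mod4 h h2 1 v.2
    rw [val_one h] at e
    rcases hr with ⟨a, b⟩ | ⟨a, ⟨b, c⟩ | ⟨b, c⟩⟩
    · right; left; exact ⟨a.symm, by simp only [b]; ring⟩
    · left; right; exact ⟨a, Or.inr ⟨by simp only []; omega, by simp only [c]; ring⟩⟩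
    · left; right; exact ⟨a, Or.inl ⟨by simp only []; omega, by simp only [c]; ring⟩⟩
  exact ⟨mkIso h ⟨fun v => (v.1, 1 - v.2), fun v => (v.1, 1 - v.2), fun v => by simp,
    fun v => by simp⟩ key key, fun i x => rfl⟩

/-- flip of the tube -/
lemma exF (h : 2 ≤ n) (h2 : 2 ∣ n) :
    ∃ g : AT n p ≃g AT n p, ∀ i x, g (i, x) = (i.rev, x + 2) := by
  have key : ∀ t : ZMod (2 * n), t.val % 4 = 2 → ∀ v w, ATRel n p v w → 
      ATRel n p (v.1.rev, v.2 + t) (w.1.rev, w.2 + t) ∨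
      ATRel n p (w.1.rev, w.2 + t) (v.1.rev, v.2 + t) := by
    intro t ht v w hr
    have e := val_add_mod4 h h2 w.2 t
    have e1 := val_add_mod4 h h2 w.2 1
    have e2 := val_add_mod4 h h2 v.2 1
    rw [val_one h] at e1 e2
    have hv := v.1.2
    have hw := w.1.2
    rcases hr with ⟨a, b⟩ | ⟨a, ⟨b, c⟩ | ⟨b, c⟩⟩
    · left; left; exact ⟨by simp only [a], by simp only [b]; ring⟩
    · right; right
      have d : v.2 = w.2 + 1 := by rw [c]; ring
      rw [← d] at e1
      refine ⟨by simp only [Fin.val_rev]; omega, Or.inr ⟨by simp only []; omega, by simp only [d]; ring⟩⟩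
    · right; right
      rw [← c] at e2
      refine ⟨by simp only [Fin.val_rev]; omega, Or.inl ⟨by simp only []; omega, by simp only [c]; ring⟩⟩
  have ht' : (-2 : ZMod (2 * n)).val % 4 = 2 := by
    have := val_sub_mod4 h h2 0 2
    rw [val_two h] at this
    simp at this
    omega
  exact ⟨mkIso h ⟨fun v => (v.1.rev, v.2 + 2), fun v => (v.1.rev, v.2 + -2), fun v => by simp,
    fun v => by simp⟩ (key 2 (by rw [val_two h])) (key (-2) ht'), fun i x => rfl⟩

/-- layer permutation -/
def sp (p x : ℕ) : Equiv.Perm (Fin (p + 1)) := if x % 4 < 2 then 1 else Fin.revPerm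

lemma exg (h : 2 ≤ n) (h2 : 2 ∣ n) (j : ZMod (2 * n)) :
    ∃ g : AT n p ≃g AT n p, ∀ i, g (i, 0) = (sp p j.val i, j) := by
  obtain ⟨S, hS⟩ := exS (p := p) h h2
  obtain ⟨F, hF⟩ := exF (p := p) h h2
  have e1 := val_sub_mod4 h h2 j 1
  have e2 := val_sub_mod4 h h2 j 2
  have e3 := val_sub_mod4 h h2 j (1 + 2)
  have e4 := val_add_mod4 h h2 1 2
  rw [val_one h] at e1 e4
  rw [val_two h] at e2 e4
  have h4 : j.val % 4 < 4 := Nat.mod_lt _ (by norm_num)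
  unfold sp
  rcases (show j.val % 4 = 0 ∨ j.val % 4 = 1 ∨ j.val % 4 = 2 ∨ j.val % 4 = 3 by omega) with
    hj | hj | hj | hj
  · obtain ⟨T, hT⟩ := exT (p := p) h h2 j hj
    exact ⟨T, fun i => by simp [hT, hj]⟩
  · obtain ⟨T, hT⟩ := exT (p := p) h h2 (j - 1) (by omega)
    exact ⟨S.trans T, fun i => by simp [hT, hS, hj]⟩
  · obtain ⟨T, hT⟩ := exT (p := p) h h2 (j - 2) (by omega)
    exact ⟨F.trans T, fun i => by simp [hT, hF, hj]⟩
  · obtain ⟨T, hT⟩ := exT (p := p) h h2 (j - (1 + 2)) (by omega)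
    exact ⟨(S.trans F).trans T, fun i => by simp [hT, hF, hS, hj]⟩

/-! ### orbit invariant -/

/-- three distinct neighbours -/
def T3 {α : Type*} (G : SimpleGraph α) (v : α) : Prop :=
  ∃ a b c, a ≠ b ∧ a ≠ c ∧ b ≠ c ∧ G.Adj v a ∧ G.Adj v b ∧ G.Adj v c

lemma T3_map {α : Type*} {G : SimpleGraph α} (g : G ≃g G) {v : α} (h : T3 G v) : T3 G (g v) := by
  obtain ⟨a, b, c, h1, h2, h3, h4, h5, h6⟩ := h
  exact ⟨g a, g b, g c, g.injective.ne h1, g.injective.ne h2, g.injective.ne h3,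
    g.map_adj_iff.2 h4, g.map_adj_iff.2 h5, g.map_adj_iff.2 h6⟩

/-- distance to the boundary -/
def dl (v : Fin (p + 1) × ZMod (2 * n)) : ℕ :=
  min (2 * (v.1 : ℕ) + v.2.val % 4 / 2) (2 * p + 1 - (2 * (v.1 : ℕ) + v.2.val % 4 / 2))

lemma dl_lip (h : 2 ≤ n) (h2 : 4 ∣ n) {u v : Fin (p + 1) × ZMod (2 * n)}
    (hr : (AT n p).Adj u v) : dl v ≤ dl u + 1 := by
  have : NeZero (2 * n) := ⟨by omega⟩
  have := adj_R h hr
  have := ZMod.val_lt u.2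
  have := ZMod.val_lt v.2
  unfold R dl at *
  obtain ⟨k, rfl⟩ := h2
  omega

lemma P_val4 (h : 2 ≤ n) (h2 : 2 ∣ n) (i : ℕ) (z : ℤ) :
    (((P n p i z).2.val : ℤ)) % 4 = z % 4 := val_mod4 h h2 z

lemma P_ne {i i' : ℕ} (hi : i ≤ p) (hi' : i' ≤ p) (z z' : ℤ) (hne : i ≠ i') :
    P n p i z ≠ P n p i' z' := by
  intro he
  have := congrArg (fun v => (v.1 : ℕ)) he
  simp only [P_val hi, P_val hi'] at this
  exact hne this

lemma P_ne4 (h : 2 ≤ n) (h2 : 2 ∣ n) (i i' : ℕ) (z z' : ℤ) (hne : z % 4 ≠ z' % 4) :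
    P n p i z ≠ P n p i' z' := by
  intro he
  have h3 := P_val4 (p := p) h h2 i z
  have h4 := P_val4 (p := p) h h2 i' z'
  rw [he] at h3
  omega

lemma P_adj1 (h : 2 ≤ n) (h2 : 2 ∣ n) {i : ℕ} (hi : i + 1 ≤ p) {z : ℤ} (hz : z % 4 = 1) :
    (AT n p).Adj (P n p (i + 1) z) (P n p i (z + 1)) := by
  have := (P_adj2 (p := p) h h2 hi (z := z + 1) (by omega)).symm
  simpa using this

lemma P_adj4 (h : 2 ≤ n) (h2 : 2 ∣ n) {i : ℕ} (hi : i + 1 ≤ p) {z : ℤ} (hz : z % 4 = 0) :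
    (AT n p).Adj (P n p (i + 1) z) (P n p i (z - 1)) := by
  have := (P_adj3 (p := p) h h2 hi (z := z - 1) (by omega)).symm
  simpa using this

lemma P_adj0' (h : 2 ≤ n) (i : ℕ) (z : ℤ) : (AT n p).Adj (P n p i z) (P n p i (z - 1)) := by
  have := (P_adj0 (p := p) h i (z - 1)).symm
  simpa using this

/-- interior vertices have a cross edge -/
lemma cross (h : 2 ≤ n) (h2 : 2 ∣ n) (i : ℕ) (hi : i ≤ p) (z : ℤ)
    (hu : (z % 4 < 2 ∧ 0 < i) ∨ (2 ≤ z % 4 ∧ i < p)) :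
    ∃ i' z', i' ≤ p ∧ (AT n p).Adj (P n p i z) (P n p i' z') ∧
      ((z % 4 < 2 ∧ i' + 1 = i ∧ 2 ≤ z' % 4) ∨ (2 ≤ z % 4 ∧ i' = i + 1 ∧ z' % 4 < 2)) := by
  rcases hu with ⟨a, b⟩ | ⟨a, b⟩
  · obtain ⟨i, rfl⟩ : ∃ k, i = k + 1 := ⟨i - 1, by omega⟩
    rcases (show z % 4 = 0 ∨ z % 4 = 1 by omega) with hz | hz
    · exact ⟨i, _, by omega, P_adj4 h h2 hi hz, by omega⟩
    · exact ⟨i, _, by omega, P_adj1 h h2 hi hz, by omega⟩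
  · rcases (show z % 4 = 2 ∨ z % 4 = 3 by omega) with hz | hz
    · exact ⟨i + 1, _, by omega, P_adj2 h h2 b hz, by omega⟩
    · exact ⟨i + 1, _, by omega, P_adj3 h h2 b hz, by omega⟩

lemma dl_P (h : 2 ≤ n) (h2 : 2 ∣ n) (i : ℕ) (hi : i ≤ p) (z : ℤ) :
    ((dl (P n p i z) : ℕ) : ℤ) = min (2 * i + z % 4 / 2) (2 * p + 1 - (2 * i + z % 4 / 2)) := by
  have := P_val4 (p := p) h h2 i z
  unfold dl
  rw [P_val hi]
  omega

lemma T3_of (h : 2 ≤ n) (h2 : 2 ∣ n) (i : ℕ) (hi : i ≤ p) (z : ℤ) (hd : dl (P n p i z) ≠ 0) :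
    T3 (AT n p) (P n p i z) := by
  have h3 := dl_P h h2 i hi z
  obtain ⟨i', z', hi', h4, h5⟩ := cross h h2 i hi z (by omega)
  exact ⟨_, _, _, P_ne4 h h2 _ _ _ _ (by omega), P_ne hi hi' _ _ (by omega),
    P_ne hi hi' _ _ (by omega), P_adj0 h i z, P_adj0' h i z, h4⟩

lemma not_T3 (h : 2 ≤ n) (h2 : 4 ∣ n) {v : Fin (p + 1) × ZMod (2 * n)} (hd : dl v = 0) :
    ¬ T3 (AT n p) v := by
  rintro ⟨a, b, c, h1, h2', h3, h4, h5, h6⟩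
  have : NeZero (2 * n) := ⟨by omega⟩
  have inj : ∀ a b : Fin (p + 1) × ZMod (2 * n), (a.1 : ℕ) = b.1 → a.2.val = b.2.val → a = b := by
    intro a b ha hb
    exact Prod.ext (Fin.ext ha) (ZMod.val_injective _ hb)
  have ka : ∀ a : Fin (p + 1) × ZMod (2 * n), (AT n p).Adj v a → (a.1 : ℕ) = v.1 ∧
      (a.2 = v.2 + 1 ∨ a.2 = v.2 - 1) := by
    intro a ha
    have e := adj_R h ha
    have := a.1.2
    have := v.1.2
    have := ZMod.val_lt a.2
    have := ZMod.val_lt v.2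
    rw [adj_iff _ _ h] at ha
    have e1 : (a.1 : ℕ) = v.1 := by
      unfold dl at hd
      unfold R at e
      obtain ⟨k, rfl⟩ := h2
      omega
    refine ⟨e1, ?_⟩
    rcases ha with (⟨_, hb⟩ | ⟨hb, _⟩) | (⟨_, hb⟩ | ⟨hb, _⟩)
    · exact Or.inl hb
    · omega
    · right; rw [hb]; ring
    · omega
  have kk : ∀ a b : Fin (p + 1) × ZMod (2 * n), (a.1 : ℕ) = v.1 → (b.1 : ℕ) = v.1 → a.2 = b.2 → a = b := by
    intro a b ha hb hc
    exact Prod.ext (Fin.ext (by omega)) hc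
  obtain ⟨a1, a2⟩ := ka a h4
  obtain ⟨b1, b2⟩ := ka b h5
  obtain ⟨c1, c2⟩ := ka c h6
  have hab := mt (kk a b a1 b1) h1
  have hac := mt (kk a c a1 c1) h2'
  have hbc := mt (kk b c b1 c1) h3
  rcases a2 with a2 | a2 <;> rcases b2 with b2 | b2 <;> rcases c2 with c2 | c2 <;>
    first
    | exact hab (a2.trans b2.symm)
    | exact hac (a2.trans c2.symm)
    | exact hbc (b2.trans c2.symm)

lemma descend (h : 2 ≤ n) (h2 : 2 ∣ n) (i : ℕ) (hi : i ≤ p) (z : ℤ) (hd : dl (P n p i z) ≠ 0) :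
    ∃ w, (AT n p).Adj (P n p i z) w ∧ dl w + 1 = dl (P n p i z) := by
  have h3 := dl_P h h2 i hi z
  obtain ⟨i', z', hi', h4, h5⟩ := cross h h2 i hi z (by omega)
  have h6 := dl_P h h2 i' hi' z'
  by_cases hc : dl (P n p i' z') + 1 = dl (P n p i z)
  · exact ⟨_, h4, hc⟩
  · rcases (show z % 4 = 0 ∨ z % 4 = 1 ∨ z % 4 = 2 ∨ z % 4 = 3 by omega) with hz | hz | hz | hz
    · refine ⟨_, P_adj0' h i z, ?_⟩
      have h7 := dl_P h h2 i hi (z - 1)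
      omega
    · refine ⟨_, P_adj0 h i z, ?_⟩
      have h7 := dl_P h h2 i hi (z + 1)
      omega
    · refine ⟨_, P_adj0' h i z, ?_⟩
      have h7 := dl_P h h2 i hi (z - 1)
      omega
    · refine ⟨_, P_adj0 h i z, ?_⟩
      have h7 := dl_P h h2 i hi (z + 1)
      omega

lemma dl_le (h : 2 ≤ n) (h2 : 4 ∣ n) (g : AT n p ≃g AT n p) (k : ℕ) :
    ∀ v, dl v = k → dl (g v) ≤ k := by
  induction k with
  | zero =>
    intro v hv
    by_contra hc
    have h3 := P_eq h (g v)
    have h4 : T3 (AT n p) (g v) := by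
      rw [h3]
      apply T3_of h (by omega) _ (by omega)
      rw [← h3]; omega
    have h5 := T3_map g.symm h4
    simp only [RelIso.symm_apply_apply] at h5
    exact not_T3 h h2 hv h5
  | succ k ih =>
    intro v hv
    have h3 := P_eq h v
    obtain ⟨w, hw, hw'⟩ := descend (p := p) h (by omega) v.1 (by omega) v.2.val (by rw [← h3]; omega)
    rw [← h3] at hw hw'
    have h4 := ih w (by omega)
    have h5 := dl_lip h h2 (g.map_adj_iff.2 hw.symm)
    omega

lemma dl_eq (h : 2 ≤ n) (h2 : 4 ∣ n) (g : AT n p ≃g AT n p) (v : Fin (p + 1) × ZMod (2 * n)) :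
    dl (g v) = dl v := by
  apply le_antisymm (dl_le h h2 g _ v rfl)
  have := dl_le h h2 g.symm _ (g v) rfl
  simpa using this

lemma orbit (h : 2 ≤ n) (h2 : 4 ∣ n) (g : AT n p ≃g AT n p) (i : Fin (p + 1)) :
    (g (i, 0)).1 = sp p (g (i, 0)).2.val i := by
  have := dl_eq h h2 g (i, 0)
  apply Fin.ext
  have h3 := (g (i, 0)).1.2
  have h4 := i.2
  unfold dl at this
  simp only [ZMod.val_zero] at this
  unfold sp
  split_ifs <;> simp only [Equiv.Perm.one_apply, Fin.revPerm_apply, Fin.val_rev] <;> omega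

lemma P_sp (h : 2 ≤ n) (i : Fin (p + 1)) (j : ZMod (2 * n)) :
    (sp p j.val i, j) = P n p (sg p j.val i) j.val := by
  have : NeZero (2 * n) := ⟨by omega⟩
  have h4 := i.2
  have hs : sg p j.val i ≤ p := by unfold sg; split_ifs <;> omega
  ext1
  · apply Fin.ext
    rw [P_val hs]
    unfold sp sg
    split_ifs <;> simp only [Equiv.Perm.one_apply, Fin.revPerm_apply, Fin.val_rev] ; omega
  · simp [P]

lemma dist_sp (h : 2 ≤ n) (h2 : 4 ∣ n) (i : Fin (p + 1)) (j : ZMod (2 * n)) :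
    (AT n p).dist (i, 0) (sp p j.val i, j) = E n p i j.val := by
  have : NeZero (2 * n) := ⟨by omega⟩
  rw [P_sp h, ← dist_eq h h2 i j.val (by omega) (ZMod.val_lt j)]
  congr 1
  rw [P_eq h (i, 0)]
  simp [P]

lemma dist_map {α : Type*} {G : SimpleGraph α} (g : G ≃g G) (u v : α) :
    G.dist (g u) (g v) = G.dist u v := by
  have key : ∀ (g : G ≃g G) (u v : α), G.dist (g u) (g v) ≤ G.dist u v ∨ ¬ G.Reachable u v := by
    intro g u v
    by_cases hr : G.Reachable u v
    · left
      obtain ⟨w, hw⟩ := hr.exists_walk_length_eq_dist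
      rw [← hw]
      simpa using SimpleGraph.dist_le (w.map g.toHom)
    · exact Or.inr hr
  by_cases hr : G.Reachable u v
  · have hr' : G.Reachable (g u) (g v) := hr.map g.toHom
    have h1 := key g u v
    have h2 := key g.symm (g u) (g v)
    simp only [RelIso.symm_apply_apply] at h2
    apply le_antisymm
    · tauto
    · tauto
  · have hr' : ¬ G.Reachable (g u) (g v) := by
      intro hc
      apply hr
      have := hc.map g.symm.toHom
      simpa using this
    rw [SimpleGraph.dist_eq_zero_of_not_reachable hr, SimpleGraph.dist_eq_zero_of_not_reachable hr']

/-! ### summation -/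

lemma sum_aut {α : Type*} (G : SimpleGraph α) [Fintype (G ≃g G)] {K : Type*} [Fintype K]
    (u : α) (g : K → (G ≃g G)) (hinj : ∀ j k, g j u = g k u → j = k)
    (hsurj : ∀ a : G ≃g G, ∃ j, a u = g j u) (f : α → ℚ) :
    (Fintype.card K : ℚ) * ∑ a : G ≃g G, f (a u) = (Fintype.card (G ≃g G) : ℚ) * ∑ j, f (g j u) := by
  classical
  let S := {a : G ≃g G // a u = u}
  let e : K × S → (G ≃g G) := fun x => g x.1 * x.2.1
  have ev : ∀ x, e x u = g x.1 u := by
    intro x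
    simp only [e, RelIso.mul_apply, x.2.2]
  have he : Function.Bijective e := by
    constructor
    · intro x y hxy
      have h1 : x.1 = y.1 := by
        apply hinj
        rw [← ev, ← ev, hxy]
      ext1
      · exact h1
      · apply Subtype.ext
        simp only [e, h1] at hxy
        exact mul_left_cancel hxy
    · intro a
      obtain ⟨j, hj⟩ := hsurj a
      refine ⟨(j, ⟨(g j)⁻¹ * a, ?_⟩), by simp [e]⟩
      rw [RelIso.mul_apply, hj, ← RelIso.mul_apply]
      simp
  have h1 : ∑ a : G ≃g G, f (a u) = Fintype.card S * ∑ j, f (g j u) := by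
    rw [← he.sum_comp (fun a => f (a u)), Fintype.sum_prod_type, Finset.mul_sum]
    simp only [ev]
    simp
  have h2 : Fintype.card (G ≃g G) = Fintype.card K * Fintype.card S := by
    rw [← Fintype.card_prod, Fintype.card_of_bijective he]
  rw [h1, h2]
  push_cast
  ring

lemma gp_eq (h : 2 ≤ n) (h2 : 4 ∣ n) : GPindex (AT n p) =
    (n : ℚ) * (p + 1) * ∑ i : Fin (p + 1), ∑ x ∈ Finset.range (2 * n), (E n p i x : ℚ) := by
  classical
  have : NeZero (2 * n) := ⟨by omega⟩
  have : Finite (AT n p ≃g AT n p) :=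
    Finite.of_injective (fun g => (g : (Fin (p + 1) × ZMod (2 * n)) → _)) DFunLike.coe_injective
  have := Fintype.ofFinite (AT n p ≃g AT n p)
  unfold GPindex
  choose g hg using exg (p := p) h (show 2 ∣ n by omega)
  have hc0 : (Nat.card (AT n p ≃g AT n p) : ℚ) ≠ 0 := by
    have : 0 < Nat.card (AT n p ≃g AT n p) := Nat.card_pos
    positivity
  have hn0 : (n : ℚ) ≠ 0 := by
    have : 0 < n := by omega
    positivity
  rw [finsum_eq_sum_of_fintype]
  simp only [finsum_eq_sum_of_fintype]
  have s1 : ∑ u : Fin (p + 1) × ZMod (2 * n), ∑ a : AT n p ≃g AT n p, ((AT n p).dist u (a u) : ℚ)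
      = 2 * n * ∑ i : Fin (p + 1), ∑ a : AT n p ≃g AT n p, ((AT n p).dist (i, 0) (a (i, 0)) : ℚ) := by
    rw [Fintype.sum_prod_type, Finset.sum_comm]
    have : ∀ j : ZMod (2 * n), ∑ i : Fin (p + 1), ∑ a : AT n p ≃g AT n p,
        ((AT n p).dist (i, j) (a (i, j)) : ℚ) =
        ∑ i : Fin (p + 1), ∑ a : AT n p ≃g AT n p, ((AT n p).dist (i, 0) (a (i, 0)) : ℚ) := by
      intro j
      rw [← Equiv.sum_comp (sp p j.val)]
      apply Finset.sum_congr rfl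
      intro i _
      rw [← hg, ← Equiv.sum_comp (MulAut.conj (g j)).toEquiv]
      apply Finset.sum_congr rfl
      intro a _
      have e : (MulAut.conj (g j)).toEquiv a (g j (i, 0)) = g j (a (i, 0)) := by
        change (g j * a * (g j)⁻¹) (g j (i, 0)) = g j (a (i, 0))
        rw [← RelIso.mul_apply, inv_mul_cancel_right, RelIso.mul_apply]
      rw [e, dist_map]
    simp only [this]
    rw [Finset.sum_const, Finset.card_univ, ZMod.card]
    simp
  have s2 : ∀ i : Fin (p + 1), ∑ a : AT n p ≃g AT n p, ((AT n p).dist (i, 0) (a (i, 0)) : ℚ) =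
      (Nat.card (AT n p ≃g AT n p) : ℚ) / (2 * n) * ∑ x ∈ Finset.range (2 * n), (E n p i x : ℚ) := by
    intro i
    have := sum_aut (AT n p) (i, (0 : ZMod (2 * n))) g ?_ ?_ (fun v => ((AT n p).dist (i, 0) v : ℚ))
    · rw [ZMod.card] at this
      simp only [hg, dist_sp h h2] at this
      have e : ∑ j : ZMod (2 * n), (E n p i j.val : ℚ) =
          ∑ x ∈ Finset.range (2 * n), (E n p i x : ℚ) := by
        refine Finset.sum_bij (fun j _ => j.val) ?_ ?_ ?_ ?_
        · intro j _; exact Finset.mem_range.2 (ZMod.val_lt j)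
        · intro a _ b _ hab; exact ZMod.val_injective _ hab
        · intro b hb
          exact ⟨(b : ZMod (2 * n)), Finset.mem_univ _, ZMod.val_cast_of_lt (Finset.mem_range.1 hb)⟩
        · intro j _; rfl
      rw [e] at this
      rw [Nat.card_eq_fintype_card]
      push_cast at this
      field_simp
      linarith
    · intro j k hjk
      rw [hg, hg] at hjk
      exact (Prod.ext_iff.1 hjk).2
    · intro a
      refine ⟨(a (i, 0)).2, ?_⟩
      rw [hg]
      exact Prod.ext (orbit h h2 a i) rfl
  rw [s1]
  simp only [s2]
  rw [← Finset.mul_sum]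
  have : (Nat.card (Fin (p + 1) × ZMod (2 * n)) : ℚ) = (p + 1) * (2 * n) := by
    rw [Nat.card_prod]
    simp
  rw [this]
  field_simp

lemma sum_four (f : ℕ → ℚ) (m : ℕ) : ∑ x ∈ Finset.range (4 * m), f x =
    ∑ q ∈ Finset.range m, (f (4 * q) + f (4 * q + 1) + f (4 * q + 2) + f (4 * q + 3)) := by
  induction m with
  | zero => simp
  | succ m ih =>
    rw [Finset.sum_range_succ, ← ih, show 4 * (m + 1) = 4 * m + 1 + 1 + 1 + 1 by ring]
    simp only [Finset.sum_range_succ]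
    ring

lemma sum_fold (f : ℕ → ℚ) (m : ℕ) : ∑ x ∈ Finset.range (2 * m), f x =
    ∑ q ∈ Finset.range m, (f q + f (2 * m - 1 - q)) := by
  rw [two_mul, Finset.sum_range_add, Finset.sum_add_distrib]
  congr 1
  rw [← Finset.sum_range_reflect]
  apply Finset.sum_congr rfl
  intro q hq
  have := Finset.mem_range.1 hq
  congr 1
  omega

/-- half vertical distance -/
def kk (p i : ℕ) : ℕ := if 2 * i ≤ p then p - 2 * i else 2 * i - p - 1

lemma inner_sum (m i : ℕ) :
    ∑ x ∈ Finset.range (2 * (4 * m)), (E (4 * m) p i x : ℚ) =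
    ∑ q ∈ Finset.range m, (24 * q + 16 + 8 * (max (kk p i) q : ℕ) : ℚ) := by
  rw [show 2 * (4 * m) = 4 * (2 * m) by ring, sum_four, sum_fold]
  apply Finset.sum_congr rfl
  intro q hq
  have := Finset.mem_range.1 hq
  have habs : (2 * ((p : ℤ) - 2 * i) + 1).natAbs = 2 * kk p i + 1 := by
    unfold kk; split_ifs <;> omega
  norm_cast
  unfold E
  rw [habs]
  generalize kk p i = k
  rw [if_pos (by omega), if_pos (by omega), if_neg (by omega), if_neg (by omega),
    if_pos (by omega), if_pos (by omega), if_neg (by omega), if_neg (by omega)]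
  omega

lemma reindex (f : ℕ → ℚ) : ∑ i : Fin (p + 1), f (kk p i) = ∑ k ∈ Finset.range (p + 1), f k := by
  rw [Fin.sum_univ_eq_sum_range (fun i => f (kk p i))]
  refine Finset.sum_nbij' (fun i => kk p i)
    (fun k => if (p + k) % 2 = 0 then (p - k) / 2 else (p + k + 1) / 2) ?_ ?_ ?_ ?_ ?_
  · intro i hi; have := Finset.mem_range.1 hi; rw [Finset.mem_range]; unfold kk; split_ifs <;> omega
  · intro i hi; have := Finset.mem_range.1 hi; rw [Finset.mem_range]; split_ifs <;> omega
  · intro i hi; have := Finset.mem_range.1 hi; unfold kk; split_ifs <;> omega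
  · intro i hi; have := Finset.mem_range.1 hi; unfold kk; split_ifs <;> omega
  · intro i _; rfl

lemma sum_max (q p : ℕ) (hq : q ≤ p) : ∑ k ∈ Finset.range (p + 1), ((max k q : ℕ) : ℚ) =
    (p * (p + 1) + q * (q + 1)) / 2 := by
  have h0 : ∀ m ≤ q + 1, ∑ k ∈ Finset.range m, ((max k q : ℕ) : ℚ) = m * q := by
    intro m hm
    induction m with
    | zero => simp
    | succ m ih =>
      rw [Finset.sum_range_succ, ih (by omega), max_eq_right (by omega)]
      push_cast; ring
  induction p, hq using Nat.le_induction with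
  | base => rw [h0 _ le_rfl]; push_cast; ring
  | succ p hp ih =>
    rw [Finset.sum_range_succ, ih, max_eq_left (by omega)]
    push_cast; ring

lemma sum_final (m : ℕ) (P : ℚ) :
    ∑ q ∈ Finset.range m, ((P + 1) * (24 * q + 16) + 8 * ((P * (P + 1) + q * (q + 1)) / 2) : ℚ) =
    (P + 1) * (12 * m ^ 2 + 4 * m) + 4 * m * P * (P + 1) + 4 * (m ^ 3 - m) / 3 := by
  induction m with
  | zero => simp
  | succ m ih =>
    rw [Finset.sum_range_succ, ih]
    push_cast
    ring

end ATProof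

theorem stmt17 (n p : ℕ) (hp : 3 ≤ p) (hpo : Odd p) (hn4 : 4 ∣ n) (hn : 12 ≤ n)
    (hle : n ≤ 4 * p) :
    GPindex (AT n p) =
      ((p : ℚ) + 1) * ((n : ℚ) ^ 4 / 48 + 3 * (n : ℚ) ^ 3 * (p : ℚ) / 4 +
        3 * (n : ℚ) ^ 3 / 4 + (n : ℚ) ^ 2 * (p : ℚ) ^ 2 + 2 * (n : ℚ) ^ 2 * (p : ℚ) +
        2 * (n : ℚ) ^ 2 / 3) := by

  obtain ⟨m, rfl⟩ := hn4
  rw [ATProof.gp_eq (by omega) ⟨m, rfl⟩]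
  have h1 : ∑ i : Fin (p + 1), ∑ x ∈ Finset.range (2 * (4 * m)), (ATProof.E (4 * m) p i x : ℚ) =
      ∑ i : Fin (p + 1), ∑ q ∈ Finset.range m,
        (24 * q + 16 + 8 * (max (ATProof.kk p i) q : ℕ) : ℚ) :=
    Finset.sum_congr rfl fun i _ => ATProof.inner_sum m i
  have h2 : ∀ q ∈ Finset.range m, ∑ k ∈ Finset.range (p + 1), (24 * q + 16 + 8 * (max k q : ℕ) : ℚ) =
      ((p : ℚ) + 1) * (24 * q + 16) + 8 * (((p : ℚ) * (p + 1) + q * (q + 1)) / 2) := by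
    intro q hq
    have := Finset.mem_range.1 hq
    rw [Finset.sum_add_distrib, ← Finset.mul_sum, ATProof.sum_max q p (by omega)]
    simp
    ring
  rw [h1, ATProof.reindex (fun k => ∑ q ∈ Finset.range m, (24 * q + 16 + 8 * (max k q : ℕ) : ℚ)),
    Finset.sum_comm, Finset.sum_congr rfl h2, ATProof.sum_final]
  push_cast
  ring
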